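/- The polynomial f(x) = x³ + 3 over the finite field F_7 is dynamically irreducible: for every positive integer n, the n-fold composition f^n is irreducible over F_7. -/

import Mathlib

open Polynomial

/-- The `n`-fold composition `f ∘ f ∘ ... ∘ f` (`n` times) of a polynomial,
with `f^0 = X` (the identity). -/
noncomputable def polyIter {K : Type*} [Field K] (f : K[X]) : ℕ → K[X]
  | 0 => X
  | n + 1 => f.comp (polyIter f n)

instance : Fact (Nat.Prime 7) := ⟨by norm_num⟩

theorem polyIter_succ_eq_comp {K : Type*} [Field K] (f : K[X]) (n : ℕ) :
    polyIter f (n + 1) = (polyIter f n).comp f := by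
  induction n with
  | zero => simp [polyIter]
  | succ n ih =>
    change f.comp (polyIter f (n + 1)) = (f.comp (polyIter f n)).comp f
    rw [ih, comp_assoc]

theorem eval_polyIter {K : Type*} [Field K] (f : K[X]) (n : ℕ) (a : K) :
    (polyIter f n).eval a = (fun x => f.eval x)^[n] a := by
  induction n with
  | zero => simp [polyIter]
  | succ n ih => rw [Function.iterate_succ_apply', ← ih, polyIter, eval_comp]

theorem monic_polyIter {K : Type*} [Field K] {f : K[X]} (hf : f.Monic) (hd : f.natDegree ≠ 0)
    (n : ℕ) : (polyIter f n).Monic := by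
  induction n with
  | zero => exact monic_X
  | succ n ih =>
    rw [polyIter_succ_eq_comp]
    exact ih.comp hf hd

theorem PowerBasis.norm_algebraMap_sub_gen {K L : Type*} [Field K] [Field L] [Algebra K L]
    (pb : PowerBasis K L) (a : K) :
    Algebra.norm K (algebraMap K L a - pb.gen) = (minpoly K pb.gen).eval a := by
  rw [← charpoly_leftMulMatrix, Matrix.eval_charpoly, Algebra.norm_eq_matrix_det pb.basis,
    map_sub, AlgHom.commutes]
  rfl

/-- The forward orbit of `3` under `x ↦ x ^ 3 + 3` in `ZMod 7` contains no cube. -/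
theorem eval_polyIter_three_ne_cube (n : ℕ) (c : ZMod 7) :
    c ^ 3 ≠ (polyIter ((X : (ZMod 7)[X]) ^ 3 + C 3) n).eval 3 := by
  have orbit : (polyIter ((X : (ZMod 7)[X]) ^ 3 + C 3) n).eval 3 ∈ ({2, 3, 4} : Finset (ZMod 7)) := by
    rw [eval_polyIter]
    induction n with
    | zero => decide
    | succ n ih =>
      rw [Function.iterate_succ_apply']
      generalize (fun x => eval x ((X : (ZMod 7)[X]) ^ 3 + C 3))^[n] 3 = y at ih ⊢
      simp only [eval_add, eval_pow, eval_X, eval_C]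
      revert y
      decide
  generalize (polyIter ((X : (ZMod 7)[X]) ^ 3 + C 3) n).eval 3 = y at orbit ⊢
  revert c y
  decide

theorem irreducible_polyIter_X_pow_three_add_three (n : ℕ) :
    Irreducible (polyIter ((X : (ZMod 7)[X]) ^ 3 + C 3) n) := by
  have hmonic : ((X : (ZMod 7)[X]) ^ 3 + C 3).Monic := monic_X_pow_add_C 3 (by norm_num)
  have hdeg : ((X : (ZMod 7)[X]) ^ 3 + C 3).natDegree ≠ 0 := by
    rw [natDegree_X_pow_add_C]; norm_num
  induction n with
  | zero => exact irreducible_X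
  | succ n ih =>
    rw [polyIter_succ_eq_comp]
    refine irreducible_comp (monic_polyIter hmonic hdeg n) hmonic ih ?_
    intro E _ _ x hx
    have hint : IsIntegral (ZMod 7) x := by
      by_contra h
      exact ih.ne_zero (hx ▸ minpoly.eq_zero h)
    have key : ((X : (ZMod 7)[X]) ^ 3 + C 3).map (algebraMap (ZMod 7) _) -
        C (IntermediateField.AdjoinSimple.gen (ZMod 7) x) =
        X ^ 3 - C (IntermediateField.AdjoinSimple.gen (ZMod 7) x - algebraMap (ZMod 7) _ 3) := by
      simp only [Polynomial.map_add, Polynomial.map_pow, map_X, map_C, C_sub]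
      ring
    rw [key]
    refine X_pow_sub_C_irreducible_of_prime Nat.prime_three fun b hb => ?_
    have hnorm := PowerBasis.norm_algebraMap_sub_gen (IntermediateField.adjoin.powerBasis hint) 3
    rw [IntermediateField.adjoin.powerBasis_gen, IntermediateField.minpoly_gen, hx] at hnorm
    apply eval_polyIter_three_ne_cube n (Algebra.norm (ZMod 7) (-b))
    rw [← hnorm, ← map_pow, Odd.neg_pow (by decide), hb, neg_sub]

theorem stmt14 :
    ∀ n : ℕ, 0 < n →
      Irreducible (polyIter ((X : (ZMod 7)[X]) ^ 3 + C 3) n) :=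
  fun n _ => irreducible_polyIter_X_pow_three_add_three n
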